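/- arXiv:2305.13881 — 2 statements merged into one kernel-verified Lean document; each statement's English description precedes it below -/
import Mathlib

section
/- If S is a saturated numerical semigroup, then S \ {m(S)} is a saturated numerical semigroup, where m(S) is the multiplicity of S. -/
/-- A numerical semigroup: subset of ℕ containing 0, closed under addition,
with finite complement. -/
def IsNumericalSemigroup (S : Set ℕ) : Prop :=
  0 ∈ S ∧ (∀ a ∈ S, ∀ b ∈ S, a + b ∈ S) ∧ Sᶜ.Finite

/-- `dOf S s = gcd {x ∈ S : x ≤ s}`. -/
noncomputable def dOf (S : Set ℕ) (s : ℕ) : ℕ :=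
  letI := Classical.decPred (· ∈ S)
  ((Finset.range (s + 1)).filter (· ∈ S)).gcd id

/-- A saturated numerical semigroup. -/
def IsSaturatedNS (S : Set ℕ) : Prop :=
  IsNumericalSemigroup S ∧ ∀ s ∈ S, s ≠ 0 → s + dOf S s ∈ S

/-- `Sat F`: saturated numerical semigroups with Frobenius number `F`. -/
def SatF (F : ℕ) : Set (Set ℕ) :=
  {S | IsSaturatedNS S ∧ F ∉ S ∧ ∀ x, x ∉ S → x ≤ F}

/-- Multiplicity: least nonzero element. -/
noncomputable def multOf (S : Set ℕ) : ℕ := sInf {x | x ∈ S ∧ x ≠ 0}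

/-- Pseudo-Frobenius numbers. -/
def PFset (S : Set ℕ) : Set ℕ := {z | z ∉ S ∧ ∀ s ∈ S, s ≠ 0 → z + s ∈ S}

/-- Special gaps. -/
def SGset (S : Set ℕ) : Set ℕ := {x | x ∈ PFset S ∧ 2 * x ∈ S}

/-- `TSet a b = ⟨a⟩ ∪ {x : x ≥ b}`. -/
def TSet (a b : ℕ) : Set ℕ := {x | a ∣ x} ∪ {x | b ≤ x}

/-- A `Sat(F)`-set. -/
def SatFSet (F : ℕ) (X : Set ℕ) : Prop :=
  X ∩ ({0} ∪ {x | F + 1 ≤ x}) = ∅ ∧ ∃ S ∈ SatF F, X ⊆ S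

/-- `Sat(F)[X]`: intersection of all elements of `Sat F` containing `X`. -/
def SatClosure (F : ℕ) (X : Set ℕ) : Set ℕ := ⋂₀ {S | S ∈ SatF F ∧ X ⊆ S}

/-- `X` is a minimal `Sat(F)`-system of generators of `S`. -/
def IsMinSatGen (F : ℕ) (X S : Set ℕ) : Prop :=
  SatFSet F X ∧ SatClosure F X = S ∧ ∀ Y : Set ℕ, Y ⊂ X → SatClosure F Y ≠ S

/-- The `Sat(F)`-rank of `S`: minimal cardinality of a `Sat(F)`-set `X`
with `Sat(F)[X] = S`. -/
noncomputable def SatRank (F : ℕ) (S : Set ℕ) : ℕ :=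
  sInf {k | ∃ X : Set ℕ, SatFSet F X ∧ SatClosure F X = S ∧ X.ncard = k}

theorem dOf_dvd {S : Set ℕ} {s x : ℕ} (hx : x ∈ S) (hxs : x ≤ s) : dOf S s ∣ x := by
  classical
  exact Finset.gcd_dvd (f := id) (by simp [hx]; omega)

theorem dvd_dOf {S : Set ℕ} {s d : ℕ} (h : ∀ x ∈ S, x ≤ s → d ∣ x) : d ∣ dOf S s := by
  classical
  refine Finset.dvd_gcd fun x hx => ?_
  simp only [Finset.mem_filter, Finset.mem_range] at hx
  exact h x hx.2 (by omega)

theorem dOf_dvd_dOf {S T : Set ℕ} {s t : ℕ} (hST : S ⊆ T) (hst : s ≤ t) :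
    dOf T t ∣ dOf S s :=
  dvd_dOf fun _ hx hxs => dOf_dvd (hST hx) (hxs.trans hst)

/-- In a saturated numerical semigroup, one may add any multiple of `dOf S s` to `s`. -/
theorem IsSaturatedNS.add_mem_of_dOf_dvd {S : Set ℕ} (hS : IsSaturatedNS S) {s e : ℕ}
    (hs : s ∈ S) (hs0 : s ≠ 0) (he : dOf S s ∣ e) : s + e ∈ S := by
  induction e using Nat.strong_induction_on generalizing s with
  | _ e ih =>
    rcases Nat.eq_zero_or_pos e with rfl | hpos
    · simpa using hs
    have hd : 0 < dOf S s := Nat.pos_of_dvd_of_pos (dOf_dvd hs le_rfl) (Nat.pos_of_ne_zero hs0)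
    have hle : dOf S s ≤ e := Nat.le_of_dvd hpos he
    have hdvd : dOf S (s + dOf S s) ∣ e - dOf S s :=
      (dOf_dvd_dOf subset_rfl (Nat.le_add_right _ _)).trans (Nat.dvd_sub he dvd_rfl)
    have := ih (e - dOf S s) (by omega) (hS.2 s hs hs0) (by omega) hdvd
    rwa [show s + dOf S s + (e - dOf S s) = s + e by omega] at this

theorem multOf_le {S : Set ℕ} {s : ℕ} (hs : s ∈ S) (hs0 : s ≠ 0) : multOf S ≤ s :=
  Nat.sInf_le ⟨hs, hs0⟩

theorem IsNumericalSemigroup.multOf_ne_zero {S : Set ℕ} (hS : IsNumericalSemigroup S) :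
    multOf S ≠ 0 := by
  obtain ⟨x, hx⟩ := (hS.2.2.union (Set.finite_singleton 0)).exists_notMem
  have hne : {x | x ∈ S ∧ x ≠ 0}.Nonempty := ⟨x, by simpa [and_comm] using hx⟩
  exact (Nat.sInf_mem hne).2

/-- if `S` is a saturated numerical semigroup, then
`S \ {m(S)}` is a saturated numerical semigroup. -/
theorem saturated_diff_multiplicity (S : Set ℕ) (hS : IsSaturatedNS S) :
    IsSaturatedNS (S \ {multOf S}) := by
  have hm := hS.1.multOf_ne_zero
  have hlt : ∀ s ∈ S \ {multOf S}, s ≠ 0 → multOf S < s := fun s hs hs0 =>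
    lt_of_le_of_ne (multOf_le hs.1 hs0) (Ne.symm hs.2)
  refine ⟨⟨⟨hS.1.1, hm.symm⟩, fun a ha b hb => ?_, ?_⟩, fun s hs hs0 => ?_⟩
  · rcases eq_or_ne a 0 with rfl | ha0
    · simpa using hb
    · have := hlt a ha ha0
      exact ⟨hS.1.2.1 a ha.1 b hb.1, by simp only [Set.mem_singleton_iff]; omega⟩
  · rw [Set.compl_sdiff]
    exact (Set.finite_singleton _).union hS.1.2.2
  · have := hlt s hs hs0
    exact ⟨hS.add_mem_of_dOf_dvd hs.1 hs0 (dOf_dvd_dOf Set.sdiff_subset le_rfl),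
      by simp only [Set.mem_singleton_iff]; omega⟩
end

section
/- Let F be a positive integer, S ∈ Sat(F), and let X = {x ∈ S\{0} : x < F and d_S(x) ≠ d_S(y) for every y ∈ S\{0} with y < x}. Then Sat(F)[X] = S. -/
/-- A number divides `dOf S s` iff it divides every element of `S` up to `s`. -/
theorem dvd_dOf_iff {S : Set ℕ} {s e : ℕ} :
    e ∣ dOf S s ↔ ∀ x ∈ S, x ≤ s → e ∣ x := by
  classical
  simp only [dOf, Finset.dvd_gcd_iff, Finset.mem_filter, Finset.mem_range, id, Nat.lt_succ_iff]
  exact ⟨fun h x hx hxs => h x ⟨hxs, hx⟩, fun h x hx => h x hx.2 hx.1⟩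

theorem dOf_dvd_dOf_of_le {S : Set ℕ} {s t : ℕ} (hst : s ≤ t) : dOf S t ∣ dOf S s :=
  dvd_dOf_iff.2 fun _ hx hxs => dOf_dvd hx (hxs.trans hst)

/-- In a saturated numerical semigroup, any multiple of `dOf T t` may be added to `t`. -/
theorem IsSaturatedNS.add_mem_of_dOf_dvd_s13 {T : Set ℕ} (hT : IsSaturatedNS T) {m t : ℕ}
    (ht : t ∈ T) (ht0 : t ≠ 0) (hm : dOf T t ∣ m) : t + m ∈ T := by
  induction m using Nat.strong_induction_on generalizing t with
  | _ m ih =>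
    rcases Nat.eq_zero_or_pos m with rfl | hmpos
    · simpa using ht
    · have hd : 0 < dOf T t := Nat.pos_of_dvd_of_pos (dOf_dvd ht le_rfl) (Nat.pos_of_ne_zero ht0)
      have hle : dOf T t ≤ m := Nat.le_of_dvd hmpos hm
      have hdvd : dOf T (t + dOf T t) ∣ m - dOf T t :=
        (dOf_dvd_dOf_of_le (Nat.le_add_right _ _)).trans (Nat.dvd_sub hm dvd_rfl)
      have h := ih (m - dOf T t) (by omega) (hT.2 t ht ht0) (by omega) hdvd
      rwa [add_assoc, Nat.add_sub_cancel' hle] at h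

/-- `S` is generated, as an element of `Sat(F)`, by the set of
its nonzero elements `x < F` whose `d_S`-value differs from that of every
smaller nonzero element. -/
theorem SatClosure_of_dS_new_values (F : ℕ) (hF : 0 < F)
    (S : Set ℕ) (hS : S ∈ SatF F) :
    SatClosure F
        {x | x ∈ S ∧ x ≠ 0 ∧ x < F ∧
          ∀ y ∈ S, y ≠ 0 → y < x → dOf S x ≠ dOf S y} = S := by
  refine Set.Subset.antisymm (Set.sInter_subset_of_mem ⟨hS, fun x hx => hx.1⟩) ?_
  rintro s hs T ⟨hT, hXT⟩
  induction s using Nat.strong_induction_on with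
  | _ s ih =>
    rcases eq_or_ne s 0 with rfl | hs0
    · exact hT.1.1.1
    by_contra hsT
    have hsF : s < F := lt_of_le_of_ne (hT.2.2 s hsT) fun h => hS.2.1 (h ▸ hs)
    have hsX : ¬ ∀ y ∈ S, y ≠ 0 → y < s → dOf S s ≠ dOf S y :=
      fun h => hsT (hXT ⟨hs, hs0, hsF, h⟩)
    push Not at hsX
    obtain ⟨y, hy, hy0, hys, hd⟩ := hsX
    have hdvd : dOf T y ∣ dOf S y :=
      dvd_dOf_iff.2 fun x hx hxy => dOf_dvd (ih x (hxy.trans_lt hys) hx) hxy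
    have hsub : dOf S y ∣ s - y :=
      Nat.dvd_sub (hd ▸ dOf_dvd hs le_rfl) (dOf_dvd hy le_rfl)
    have h := hT.1.add_mem_of_dOf_dvd_s13 (ih y hys hy) hy0 (hdvd.trans hsub)
    rw [Nat.add_sub_cancel' hys.le] at h
    exact hsT h
end
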